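/- Fix an integer n ≥ 1 and let k = 12ℓ + k', k' ∈ {0,4,6,8,10,14}. If m satisfies (A_n/(−B_n))·k + C_n(k')/(−B_n) < m ≤ ℓ − n, then at least one zero of the Miller basis form f_{k,m} is not on the arc 𝒜, i.e., at least one zero of its Faber polynomial F_{k,m} lies outside [0,1728]. Here A_n = (1/2π)∫_{π/2}^{2π/3} j(e^{iθ})^n dθ, B_n = −c_n(0) with c_n(0) > 0 the coefficient of q^0 in j^n, C_n(k') = 0 for k' ∈ {0,4,8} and C_n(k') = −1728^n/2 for k' ∈ {6,10,14}. -/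

import Mathlib

open Complex Polynomial Real MeasureTheory Filter Topology

noncomputable section

/-- `q = e^{2πiz}`. -/
def qexp (z : ℂ) : ℂ := Complex.exp (2 * Real.pi * Complex.I * z)

/-- The normalized Eisenstein series `E_k(z) = (1/2) ∑_{gcd(c,d)=1} (cz+d)^{-k}`,
with the convention `E_0 = 1`. -/
def Eis (k : ℕ) (z : ℂ) : ℂ :=
  if k = 0 then 1
  else (1 / 2) * ∑' p : ℤ × ℤ, if Int.gcd p.1 p.2 = 1 then 1 / ((p.1 : ℂ) * z + (p.2 : ℂ)) ^ k else 0

/-- The modular discriminant `Δ(z) = q ∏_{n ≥ 1} (1 - q^n)^24`, `q = e^{2πiz}`. -/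
def Disc (z : ℂ) : ℂ := qexp z * ∏' n : ℕ, (1 - qexp z ^ (n + 1)) ^ 24

/-- The modular `j`-invariant `j = E₄³ / Δ`. -/
def jinv (z : ℂ) : ℂ := Eis 4 z ^ 3 / Disc z

/-- The coefficient of `q^d` in the Fourier/`q`-expansion of a `1`-periodic function
holomorphic on the upper half-plane, computed at height `1`. -/
def qCoeff (f : ℂ → ℂ) (d : ℤ) : ℂ :=
  ∫ x in (0:ℝ)..1,
    f (x + Complex.I) * Complex.exp (-(2 * Real.pi * Complex.I * d * (x + Complex.I)))

/-- `c_N(d)`: the coefficient of `q^d` in the Laurent expansion of `j^N`. -/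
def cj (N : ℕ) (d : ℤ) : ℂ := qCoeff (fun z => jinv z ^ N) d

/-- `A_n = (1/2π) ∫_{π/2}^{2π/3} j(e^{iθ})^n dθ`. -/
def Acoef (n : ℕ) : ℂ :=
  (1 / (2 * Real.pi)) *
    ∫ θ in (Real.pi / 2)..(2 * Real.pi / 3), jinv (Complex.exp (θ * Complex.I)) ^ n

/-- `B_n = -c_n(0)`, where `c_n(0)` is the coefficient of `q^0` in `j^n`. -/
def Bcoef (n : ℕ) : ℂ := - cj n 0

/-- `C_n(k') = 0` for `k' ∈ {0,4,8}` and `C_n(k') = -1728^n/2` for `k' ∈ {6,10,14}`. -/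
def Ccoef (n k' : ℕ) : ℂ := if k' = 6 ∨ k' = 10 ∨ k' = 14 then -(1728 : ℂ) ^ n / 2 else 0

/-- Real-valued version of `A_n` (recall `j` is real on the arc). -/
def AcoefR (n : ℕ) : ℝ :=
  (1 / (2 * Real.pi)) *
    ∫ θ in (Real.pi / 2)..(2 * Real.pi / 3), (jinv (Complex.exp (θ * Complex.I)) ^ n).re

/-- Real-valued version of `B_n = -c_n(0)` (recall `c_n(0)` is an integer). -/
def BcoefR (n : ℕ) : ℝ := - (cj n 0).re

/-- Real-valued version of `C_n(k')`. -/
def CcoefR (n k' : ℕ) : ℝ := if k' = 6 ∨ k' = 10 ∨ k' = 14 then -(1728 : ℝ) ^ n / 2 else 0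

/-- `f` is the `m`-th element `f_{k,m} = q^m + O(q^{ℓ+1})` of the Miller basis of `M_k`,
`k = 12ℓ + k'`: it is holomorphic on the upper half-plane, weight-`k` modular for
`SL₂(ℤ)`, and has a convergent `q`-expansion whose coefficients in degrees `≤ ℓ`
are `δ_{d,m}`. -/
def IsMillerForm (ℓ k' m : ℕ) (f : ℂ → ℂ) : Prop :=
  (∀ z : ℂ, 0 < z.im → DifferentiableAt ℂ f z) ∧
  (∀ z : ℂ, 0 < z.im → f (z + 1) = f z) ∧
  (∀ z : ℂ, 0 < z.im → f (-1 / z) = z ^ (12 * ℓ + k') * f z) ∧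
  (∃ a : ℕ → ℂ,
    (∀ z : ℂ, 0 < z.im →
      Summable (fun n : ℕ => a n * qexp z ^ n) ∧ f z = ∑' n : ℕ, a n * qexp z ^ n) ∧
    (∀ d : ℕ, d ≤ ℓ → a d = if d = m then 1 else 0))

/-- `F` is the Faber polynomial of `f = f_{k,m}`, `k = 12ℓ + k'`: the monic polynomial
of degree `ℓ - m` with `f = Δ^ℓ ⬝ E_{k'} ⬝ F(j)`. -/
def IsFaber (ℓ k' m : ℕ) (f : ℂ → ℂ) (F : Polynomial ℂ) : Prop :=
  F.Monic ∧ F.natDegree = ℓ - m ∧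
  ∀ z : ℂ, 0 < z.im → f z = Disc z ^ ℓ * Eis k' z * F.eval (jinv z)

/-- The sum of the `n`-th powers of the zeros of `F`, counted with multiplicity. -/
def powerSumRoots (F : Polynomial ℂ) (n : ℕ) : ℂ := (F.roots.map (fun x => x ^ n)).sum

/-- The (finite) solutions of `d_1 + 2 d_2 + ⋯ + n d_n = n` in nonnegative integers,
indexed by `Fin n` (so index `t : Fin n` stands for `d_{t+1}`).  Note any solution
automatically has `d_t ≤ n`. -/
def sols (n : ℕ) : Finset (Fin n → ℕ) :=
  (Fintype.piFinset fun _ : Fin n => Finset.range (n + 1)).filter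
    (fun d => ∑ t : Fin n, ((t : ℕ) + 1) * d t = n)

section Formal
open PowerSeries

/-- formal logarithmic derivative -/
def fL (W : PowerSeries ℂ) : PowerSeries ℂ :=
  PowerSeries.X * PowerSeries.derivative ℂ W * W⁻¹

lemma fL_mul {U V : PowerSeries ℂ} (hU : PowerSeries.constantCoeff U ≠ 0) (hV : PowerSeries.constantCoeff V ≠ 0) :
    fL (U * V) = fL U + fL V := by
  have h1 : U * U⁻¹ = 1 := PowerSeries.mul_inv_cancel U hU
  have h2 : V * V⁻¹ = 1 := PowerSeries.mul_inv_cancel V hV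
  simp only [fL, PowerSeries.mul_inv_rev, Derivation.leibniz, smul_eq_mul]
  linear_combination (PowerSeries.X * (PowerSeries.derivative ℂ) V * V⁻¹) * h1 + (PowerSeries.X * (PowerSeries.derivative ℂ) U * U⁻¹) * h2

lemma fL_one : fL 1 = 0 := by simp [fL]

lemma fL_pow {U : PowerSeries ℂ} (hU : PowerSeries.constantCoeff U ≠ 0) (r : ℕ) :
    fL (U ^ r) = r • fL U := by
  induction r with
  | zero => simp [fL_one]
  | succ r ih =>
    rw [pow_succ, fL_mul (by simpa using pow_ne_zero _ hU) hU, ih, succ_nsmul]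

/-- the functional used to extract power sums -/
def lam (J : PowerSeries ℂ) (n : ℕ) (S : PowerSeries ℂ) : ℂ := PowerSeries.coeff n (J ^ n * fL S)

lemma lam_mul (J : PowerSeries ℂ) (n : ℕ) {U V : PowerSeries ℂ}
    (hU : PowerSeries.constantCoeff U ≠ 0) (hV : PowerSeries.constantCoeff V ≠ 0) :
    lam J n (U * V) = lam J n U + lam J n V := by
  simp [lam, fL_mul hU hV, mul_add]

lemma lam_pow (J : PowerSeries ℂ) (n : ℕ) {U : PowerSeries ℂ}
    (hU : PowerSeries.constantCoeff U ≠ 0) (r : ℕ) : lam J n (U ^ r) = r * lam J n U := by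
  rw [lam, fL_pow hU, mul_smul_comm, map_nsmul, nsmul_eq_mul, lam]

lemma lam_linear (J : PowerSeries ℂ) (hJ : PowerSeries.constantCoeff J = 1) (n : ℕ) (x : ℂ) :
    lam J n (J - PowerSeries.C x * PowerSeries.X) = PowerSeries.coeff n (J ^ n) - x ^ n := by
  set K := J - PowerSeries.C x * PowerSeries.X with hK
  have hK0 : PowerSeries.constantCoeff K = 1 := by simp [hK, hJ]
  have hKK : K * K⁻¹ = 1 := PowerSeries.mul_inv_cancel K (by simp [hK0])
  have hgeo : J ^ n - (PowerSeries.C x * PowerSeries.X) ^ n =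
      (∑ i ∈ Finset.range n, J ^ i * (PowerSeries.C x * PowerSeries.X) ^ (n - 1 - i)) * K := by
    rw [hK, Commute.geom_sum₂_mul (Commute.all _ _)]
  have h1 : J ^ n * fL K = (PowerSeries.C x * PowerSeries.X) ^ n * fL K +
      ∑ i ∈ Finset.range n, J ^ i * (PowerSeries.C x * PowerSeries.X) ^ (n - 1 - i) * (PowerSeries.X * PowerSeries.derivative ℂ K) := by
    rw [← Finset.sum_mul, fL]
    linear_combination (PowerSeries.X * PowerSeries.derivative ℂ K * K⁻¹) * hgeo +
      (∑ i ∈ Finset.range n, J ^ i * (PowerSeries.C x * PowerSeries.X) ^ (n - 1 - i)) * (PowerSeries.X * PowerSeries.derivative ℂ K) * hKK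
  have h2 : PowerSeries.coeff n ((PowerSeries.C x * PowerSeries.X) ^ n * fL K) = 0 := by
    have : (PowerSeries.C x * PowerSeries.X) ^ n * fL K = PowerSeries.C (x^n) * (PowerSeries.X ^ n * fL K) := by
      rw [mul_pow, map_pow]; ring
    rw [this, PowerSeries.coeff_C_mul]
    have := PowerSeries.coeff_X_pow_mul (fL K) n 0
    simp only [zero_add] at this
    rw [this]; simp [fL]
  have h3 : ∀ i ∈ Finset.range n, PowerSeries.coeff n (J ^ i * (PowerSeries.C x * PowerSeries.X) ^ (n - 1 - i) * (PowerSeries.X * PowerSeries.derivative ℂ K))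
      = x ^ (n - (i + 1)) * PowerSeries.coeff (i+1) (J ^ (i+1)) - x ^ (n - i) * PowerSeries.coeff i (J ^ i) := by
    intro i hi
    have hi : i < n := Finset.mem_range.1 hi
    obtain ⟨r, rfl⟩ : ∃ r, n = r + i + 1 := ⟨n - i - 1, by omega⟩
    have e1 : r + i + 1 - 1 - i = r := by omega
    have e2 : r + i + 1 - (i + 1) = r := by omega
    have e3 : r + i + 1 - i = r + 1 := by omega
    rw [e1, e2, e3]
    have hd : PowerSeries.derivative ℂ K = PowerSeries.derivative ℂ J - PowerSeries.C x := by
      simp [hK, Derivation.leibniz]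
    have hp : PowerSeries.derivative ℂ (J ^ (i+1)) = PowerSeries.C ((i:ℂ)+1) * (J ^ i * PowerSeries.derivative ℂ J) := by
      rw [Derivation.leibniz_pow]; simp [nsmul_eq_mul]
    have hi0 : (i:ℂ) + 1 ≠ 0 := by exact_mod_cast Nat.succ_ne_zero i
    have : J ^ i * (PowerSeries.C x * PowerSeries.X) ^ r * (PowerSeries.X * PowerSeries.derivative ℂ K)
        = PowerSeries.C (x ^ r * ((i:ℂ)+1)⁻¹) * (PowerSeries.X ^ (r + 1) * PowerSeries.derivative ℂ (J ^ (i+1)))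
          - PowerSeries.C (x ^ (r+1)) * (PowerSeries.X ^ (r+1) * J ^ i) := by
      have hC : PowerSeries.C ((i:ℂ)+1)⁻¹ * PowerSeries.C ((i:ℂ)+1) = (1 : PowerSeries ℂ) := by
        rw [← map_mul, inv_mul_cancel₀ hi0, map_one]
      rw [hd, hp]
      simp only [map_mul, map_pow, mul_pow]
      linear_combination (-(PowerSeries.C x) ^ r * PowerSeries.X ^ (r+1) * J ^ i * PowerSeries.derivative ℂ J) * hC
    rw [this, map_sub, PowerSeries.coeff_C_mul, PowerSeries.coeff_C_mul]
    have a1 := PowerSeries.coeff_X_pow_mul (PowerSeries.derivative ℂ (J ^ (i+1))) (r+1) i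
    have a2 := PowerSeries.coeff_X_pow_mul (J ^ i) (r+1) i
    rw [show i + (r + 1) = r + i + 1 by omega] at a1 a2
    rw [a1, a2, PowerSeries.coeff_derivative]
    field_simp
  rw [lam, h1, map_add, h2, map_sum, Finset.sum_congr rfl h3, zero_add,
    Finset.sum_range_sub (fun i => x ^ (n - i) * PowerSeries.coeff i (J ^ i))]
  simp

lemma constantCoeff_lin (J : PowerSeries ℂ) (hJ : PowerSeries.constantCoeff J = 1) (s : Multiset ℂ) :
    PowerSeries.constantCoeff (s.map (fun x => J - PowerSeries.C x * PowerSeries.X)).prod = 1 := by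
  induction s using Multiset.induction_on with
  | empty => simp
  | cons a s ih => simp [ih, hJ]

lemma lam_roots (J : PowerSeries ℂ) (hJ : PowerSeries.constantCoeff J = 1) (n : ℕ) (s : Multiset ℂ) :
    lam J n (s.map (fun x => J - PowerSeries.C x * PowerSeries.X)).prod =
      s.card * PowerSeries.coeff n (J ^ n) - (s.map (fun x => x ^ n)).sum := by
  induction s using Multiset.induction_on with
  | empty => simp [lam, fL_one]
  | cons a s ih =>
    rw [Multiset.map_cons, Multiset.prod_cons, lam_mul, ih, lam_linear J hJ]
    · simp; ring
    · simp [hJ]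
    · rw [constantCoeff_lin J hJ]; simp

lemma lam_eq_zero (J : PowerSeries ℂ) (n N : ℕ) (hnN : n ≤ N) (W : PowerSeries ℂ)
    (hW : ∀ i, 1 ≤ i → i ≤ N → PowerSeries.coeff i W = 0) : lam J n W = 0 := by
  have h : PowerSeries.X ^ (n + 1) ∣ PowerSeries.X * PowerSeries.derivative ℂ W := by
    rw [PowerSeries.X_pow_dvd_iff]
    intro i hi
    rcases i with _ | i
    · simp
    · rw [PowerSeries.coeff_succ_X_mul, PowerSeries.coeff_derivative, hW (i+1) (by omega) (by omega)]; simp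
  obtain ⟨V, hV⟩ := h
  have : J ^ n * fL W = PowerSeries.X ^ (n+1) * (J ^ n * V * W⁻¹) := by
    rw [fL, hV]; ring
  rw [lam, this, PowerSeries.coeff_X_pow_mul']
  simp

/-- The formal power-sum identity. -/
lemma formal_identity (D E4 E6 J : PowerSeries ℂ) (hD : PowerSeries.constantCoeff D = 1)
    (h4 : PowerSeries.constantCoeff E4 = 1) (h6 : PowerSeries.constantCoeff E6 = 1) (hJ : PowerSeries.constantCoeff J = 1)
    (e1 : E4 ^ 3 = D * J) (e2 : E6 ^ 2 = D * (J - PowerSeries.C 1728 * PowerSeries.X))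
    (n : ℕ) (hn : 1 ≤ n) (l a b m : ℕ) (hml : m + n ≤ l) (s : Multiset ℂ)
    (hs : s.card = l - m)
    (hW : ∀ i, 1 ≤ i → i ≤ l - m →
      PowerSeries.coeff i (D ^ l * E4 ^ a * E6 ^ b * (s.map (fun x => J - PowerSeries.C x * PowerSeries.X)).prod) = 0)
    (A : ℂ) (hA : lam J n D + PowerSeries.coeff n (J ^ n) = 12 * A) :
    (s.map (fun x => x ^ n)).sum =
      (12 * l + 4 * a + 6 * b) * A - m * PowerSeries.coeff n (J ^ n) - b * (1728 ^ n / 2) := by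
  have hW := lam_eq_zero J n (l - m) (by omega) _ hW
  have n1 := congrArg (lam J n) e1
  have n2 := congrArg (lam J n) e2
  have hj := lam_linear J hJ n 0
  simp only [map_zero, zero_mul, sub_zero, zero_pow (by omega : n ≠ 0)] at hj
  rw [lam_pow J n (by simp [h4]), lam_mul J n (by simp [hD]) (by simp [hJ]), hj] at n1
  rw [lam_pow J n (by simp [h6]), lam_mul J n (by simp [hD]) (by simp [hJ]),
    lam_linear J hJ] at n2
  rw [lam_mul J n (by simp [hD, h4, h6]) (by simp [constantCoeff_lin J hJ]),
    lam_mul J n (by simp [hD, h4]) (by simp [h6]), lam_mul J n (by simp [hD]) (by simp [h4]),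
    lam_pow J n (by simp [hD]), lam_pow J n (by simp [h4]), lam_pow J n (by simp [h6]),
    lam_roots J hJ, hs] at hW
  rw [Nat.cast_sub (by omega)] at hW
  push_cast at n1 n2
  linear_combination -hW + (a/3 : ℂ) * n1 + (b/2 : ℂ) * n2 + (l + a / 3 + b / 2) * hA

end Formal
section Taylor
open UpperHalfPlane Function
open scoped Manifold

lemma qexp_eq (z : ℂ) : qexp z = Function.Periodic.qParam 1 z := by
  simp [qexp, Function.Periodic.qParam]

lemma qexp_ne_zero (z : ℂ) : qexp z ≠ 0 := Complex.exp_ne_zero _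

lemma norm_qexp_lt_one {z : ℂ} (hz : 0 < z.im) : ‖qexp z‖ < 1 := by
  rw [qexp_eq]; exact Function.Periodic.norm_qParam_lt_one one_pos hz

lemma exists_qexp {q : ℂ} (hq : ‖q‖ < 1) (h0 : q ≠ 0) : ∃ z : ℂ, 0 < z.im ∧ qexp z = q :=
  ⟨Function.Periodic.invQParam 1 q, Function.Periodic.im_invQParam_pos_of_norm_lt_one one_pos hq h0,
    by rw [qexp_eq, Function.Periodic.qParam_right_inv one_ne_zero h0]⟩

/-- Taylor series at `0`. -/
def TS (g : ℂ → ℂ) : PowerSeries ℂ :=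
  PowerSeries.mk fun n => ((n.factorial : ℂ))⁻¹ * iteratedDeriv n g 0

lemma TS_congr {f g : ℂ → ℂ} (h : f =ᶠ[𝓝 0] g) : TS f = TS g := by
  ext n
  simp [TS, h.iteratedDeriv_eq]

lemma TS_const (f : ℂ → ℂ) : PowerSeries.constantCoeff (TS f) = f 0 := by
  rw [← PowerSeries.coeff_zero_eq_constantCoeff_apply]; simp [TS]

lemma TS_mul {f g : ℂ → ℂ} (hf : AnalyticAt ℂ f 0) (hg : AnalyticAt ℂ g 0) :
    TS (f * g) = TS f * TS g := by
  ext
  simp only [TS, PowerSeries.coeff_mk,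
    iteratedDeriv_mul hf.contDiffAt hg.contDiffAt, Finset.mul_sum, PowerSeries.coeff_mul,
    Finset.Nat.sum_antidiagonal_eq_sum_range_succ_mk, Nat.succ_eq_add_one]
  refine Finset.sum_congr rfl fun i hi ↦ ?_
  rw [Nat.cast_choose _ (by grind)]
  field_simp [Nat.factorial_ne_zero]

lemma TS_one : TS 1 = 1 := by
  ext n
  have : (1 : ℂ → ℂ) = fun _ => 1 := rfl
  rw [TS, PowerSeries.coeff_mk, PowerSeries.coeff_one, this, iteratedDeriv_const]
  split_ifs with h <;> simp [h]

lemma TS_pow {f : ℂ → ℂ} (hf : AnalyticAt ℂ f 0) (r : ℕ) : TS (f ^ r) = TS f ^ r := by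
  induction r with
  | zero => simp [TS_one]
  | succ r ih => rw [pow_succ, TS_mul (hf.pow r) hf, ih, pow_succ]

lemma TS_sub {f g : ℂ → ℂ} (hf : AnalyticAt ℂ f 0) (hg : AnalyticAt ℂ g 0) :
    TS (f - g) = TS f - TS g := by
  ext n
  simp [TS, iteratedDeriv_sub hf.contDiffAt hg.contDiffAt, mul_sub]

lemma TS_deriv (f : ℂ → ℂ) : TS (deriv f) = PowerSeries.derivative ℂ (TS f) := by
  ext n
  have h : ((n.factorial : ℂ)) ≠ 0 := by exact_mod_cast n.factorial_ne_zero
  have h' : ((n : ℂ) + 1) ≠ 0 := by exact_mod_cast n.succ_ne_zero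
  rw [PowerSeries.coeff_derivative]
  simp only [TS, PowerSeries.coeff_mk, iteratedDeriv_succ', Nat.factorial_succ]
  push_cast
  field_simp

/-- composite with `q` as a function on the upper half plane -/
def cq (g : ℂ → ℂ) : ℍ → ℂ := fun τ => g (qexp τ)

lemma cuspFunction_cq {g : ℂ → ℂ} (hg : ContinuousAt g 0) {q : ℂ} (hq : ‖q‖ < 1) :
    UpperHalfPlane.cuspFunction 1 (cq g) q = g q := by
  have key : ∀ q : ℂ, ‖q‖ < 1 → q ≠ 0 → UpperHalfPlane.cuspFunction 1 (cq g) q = g q := by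
    intro q hq h0
    rw [UpperHalfPlane.cuspFunction, Function.Periodic.cuspFunction_eq_of_nonzero _ _ h0,
      Function.comp_apply, UpperHalfPlane.ofComplex_apply_of_im_pos
        (Function.Periodic.im_invQParam_pos_of_norm_lt_one one_pos hq h0), cq, qexp_eq]
    simp only
    rw [Function.Periodic.qParam_right_inv one_ne_zero h0]
  rcases eq_or_ne q 0 with rfl | h0
  · rw [UpperHalfPlane.cuspFunction, Function.Periodic.cuspFunction_zero_eq_limUnder_nhds_ne]
    refine Tendsto.limUnder_eq ?_
    refine (tendsto_nhdsWithin_of_tendsto_nhds hg.tendsto).congr' ?_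
    have : ∀ᶠ q : ℂ in 𝓝[≠] 0, ‖q‖ < 1 := by
      refine nhdsWithin_le_nhds ?_
      simpa [Metric.ball, dist_zero_right] using Metric.ball_mem_nhds (0:ℂ) one_pos
    filter_upwards [this, self_mem_nhdsWithin] with q h1 h2
    exact (key q h1 h2).symm
  · exact key q hq h0

lemma cuspFunction_cq_ev {g : ℂ → ℂ} (hg : ContinuousAt g 0) :
    UpperHalfPlane.cuspFunction 1 (cq g) =ᶠ[𝓝 0] g := by
  filter_upwards [Metric.ball_mem_nhds (0:ℂ) one_pos] with q hq
  exact cuspFunction_cq hg (by simpa using hq)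

lemma TS_eq_qExpansion {g : ℂ → ℂ} (hg : ContinuousAt g 0) :
    TS g = UpperHalfPlane.qExpansion 1 (cq g) := by
  rw [← TS_congr (cuspFunction_cq_ev hg)]; rfl

lemma TS_unique {g : ℂ → ℂ} (hg : AnalyticAt ℂ g 0) (a : ℕ → ℂ)
    (h : ∀ z : ℂ, 0 < z.im → HasSum (fun n => a n * qexp z ^ n) (g (qexp z))) :
    TS g = PowerSeries.mk a := by
  ext n
  rw [TS_eq_qExpansion hg.continuousAt, PowerSeries.coeff_mk]
  have h1 : AnalyticAt ℂ (UpperHalfPlane.cuspFunction 1 (cq g)) 0 :=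
    hg.congr (cuspFunction_cq_ev hg.continuousAt).symm
  have h2 : ∀ τ : ℍ, HasSum (fun m ↦ a m • Function.Periodic.qParam 1 τ ^ m) (cq g τ) := by
    intro τ
    have := h τ τ.im_pos
    simp only [qexp_eq] at this
    simpa only [cq, qexp_eq, smul_eq_mul] using this
  have h3 := (UpperHalfPlane.hasFPowerSeriesOnBall_cuspFunction (f := cq g) one_pos h1
    h2).hasFPowerSeriesAt
  have h4 := congr_arg (FormalMultilinearSeries.coeff · n)
    (h3.eq_formalMultilinearSeries h1.hasFPowerSeriesAt)
  simp only [FormalMultilinearSeries.coeff_ofScalars] at h4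
  rw [h4, UpperHalfPlane.qExpansion_coeff, div_eq_inv_mul]

lemma TS_coeff_integral {g : ℂ → ℂ} (hg : DifferentiableOn ℂ g (Metric.ball 0 1)) (n : ℕ) :
    PowerSeries.coeff n (TS g) =
      ∫ u in (0:ℝ)..1, g (qexp (u + Complex.I)) / qexp (u + Complex.I) ^ n := by
  have hc : ContinuousAt g 0 :=
    (hg.differentiableAt (Metric.ball_mem_nhds _ one_pos)).continuousAt
  have hper : Function.Periodic (cq g ∘ ofComplex) ((1:ℝ):ℂ) := by
    intro w
    by_cases hw : 0 < w.im
    · have h1 : 0 < (w + ((1:ℝ):ℂ)).im := by simpa using hw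
      simp only [comp_apply, ofComplex_apply_of_im_pos hw, ofComplex_apply_of_im_pos h1, cq]
      congr 1
      simp only [qexp]
      rw [show 2 * (π:ℂ) * Complex.I * (w + ((1:ℝ):ℂ)) = 2 * π * Complex.I * w + 2 * π * Complex.I by push_cast; ring,
        Complex.exp_periodic]
    · have h1 : ¬ 0 < (w + ((1:ℝ):ℂ)).im := by simpa using hw
      rw [comp_apply, comp_apply, ofComplex_apply_of_im_nonpos (not_lt.1 hw),
        ofComplex_apply_of_im_nonpos (not_lt.1 h1)]
  have hdiff : MDiff (cq g) := by
    rw [UpperHalfPlane.mdifferentiable_iff]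
    have : DifferentiableOn ℂ (fun z => g (qexp z)) {z | 0 < z.im} := by
      refine hg.comp (t := Metric.ball 0 1) (Differentiable.differentiableOn ?_) ?_
      · unfold qexp; fun_prop
      · intro z hz; simpa using norm_qexp_lt_one hz
    refine this.congr fun z hz => ?_
    simp [cq, ofComplex_apply_of_im_pos hz]
  have hbd : IsBoundedAtImInfty (cq g) := by
    have : Tendsto (cq g) atImInfty (𝓝 (g 0)) := by
      have := hc.tendsto.comp (UpperHalfPlane.qParam_tendsto_atImInfty one_pos)
      refine this.congr fun τ => ?_
      simp [cq, qexp_eq]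
    exact this.isBigO_one ℝ
  have := UpperHalfPlane.qExpansion_coeff_eq_intervalIntegral one_pos hper hdiff hbd n
    (t := 1) one_pos
  rw [TS_eq_qExpansion hc, this]
  simp only [ofReal_one, one_mul, div_one, cq, ← qexp_eq]
  congr 1
  ext u
  simp only [UpperHalfPlane.coe_I]
  ring

end Taylor
section EisM
open UpperHalfPlane ModularForm EisensteinSeries
open scoped MatrixGroups

lemma Eis_eq_E {k : ℕ} (hk : 3 ≤ k) (z : ℍ) : Eis k z = ModularForm.E hk z := by
  have h1 : ModularForm.E hk z = (1/2 : ℂ) * ∑' v : gammaSet 1 1 0, eisSummand k v z := rfl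
  rw [h1, Eis, if_neg (by omega)]
  congr 1
  rw [tsum_subtype (gammaSet 1 1 0) (fun v => eisSummand k v z),
    ← (finTwoArrowEquiv ℤ).symm.tsum_eq]
  refine tsum_congr fun p => ?_
  simp only [Set.indicator, gammaSet_one_mem_iff, eisSummand, finTwoArrowEquiv_symm_apply]
  simp

lemma E_unique {k : ℕ} (hk : 3 ≤ k) (hk2 : Even k)
    (hr : Module.rank ℂ (CuspForm 𝒮ℒ (k:ℤ)) = 0) (g : ModularForm 𝒮ℒ (k:ℤ))
    (hg : (qExpansion 1 g).coeff 0 = 1) : ModularForm.E hk = g := by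
  have h1 : Module.rank ℂ (ModularForm 𝒮ℒ (k:ℤ)) = 1 := by
    rw [ModularForm.rank_eq_one_add_rank_cuspForm hk hk2, hr, add_zero]
  obtain ⟨c, hc⟩ := (finrank_eq_one_iff_of_nonzero' (ModularForm.E hk) (E_ne_zero _ hk2)).mp
      (Module.rank_eq_one_iff_finrank_eq_one.mp h1) g
  have h2 : (qExpansion 1 g).coeff 0 = c := by
    rw [← hc, FunLike.coe_smul, ModularForm.qExpansion_smul, PowerSeries.coeff_smul,
      E_qExpansion_coeff_zero hk hk2]
    all_goals simp
  rw [← hc, ← h2, hg, one_smul]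

lemma E8_eq (z : ℍ) : ModularForm.E (k := 8) (by norm_num) z = E₄ z ^ 2 := by
  have h := E_unique (k := 8) (by norm_num) ⟨4, rfl⟩
    (CuspForm.rank_eq_zero_of_weight_lt_twelve (by norm_num))
    (ModularForm.mcast (by norm_num) (E₄.mul E₄)) (by
      rw [coe_mcast, ModularForm.qExpansion_mul one_pos one_mem_strictPeriods_SL]
      simp [PowerSeries.coeff_mul, -PowerSeries.coeff_zero_eq_constantCoeff,
        E_qExpansion_coeff_zero _ ⟨2, rfl⟩])
  rw [h, coe_mcast, ModularForm.coe_mul, Pi.mul_apply, sq]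

lemma E10_eq (z : ℍ) : ModularForm.E (k := 10) (by norm_num) z = E₄ z * E₆ z := by
  have h := E_unique (k := 10) (by norm_num) ⟨5, rfl⟩
    (CuspForm.rank_eq_zero_of_weight_lt_twelve (by norm_num))
    (ModularForm.mcast (by norm_num) (E₄.mul E₆)) (by
      rw [coe_mcast, ModularForm.qExpansion_mul one_pos one_mem_strictPeriods_SL]
      simp [PowerSeries.coeff_mul, -PowerSeries.coeff_zero_eq_constantCoeff,
        E_qExpansion_coeff_zero _ ⟨2, rfl⟩, E_qExpansion_coeff_zero _ ⟨3, rfl⟩])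
  rw [h, coe_mcast, ModularForm.coe_mul, Pi.mul_apply]

lemma E14_eq (z : ℍ) : ModularForm.E (k := 14) (by norm_num) z = E₄ z ^ 2 * E₆ z := by
  have hr : Module.rank ℂ (CuspForm 𝒮ℒ ((14:ℕ):ℤ)) = 0 :=
    CuspForm.discriminantEquiv.rank_eq.trans levelOne_weight_two_rank_zero
  have h := E_unique (k := 14) (by norm_num) ⟨7, rfl⟩ hr
    (ModularForm.mcast (by norm_num) ((E₄.mul E₄).mul E₆)) (by
      rw [coe_mcast, ModularForm.qExpansion_mul one_pos one_mem_strictPeriods_SL,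
        ModularForm.qExpansion_mul one_pos one_mem_strictPeriods_SL]
      simp [PowerSeries.coeff_mul, -PowerSeries.coeff_zero_eq_constantCoeff,
        E_qExpansion_coeff_zero _ ⟨2, rfl⟩, E_qExpansion_coeff_zero _ ⟨3, rfl⟩])
  rw [h, coe_mcast, ModularForm.coe_mul, Pi.mul_apply, ModularForm.coe_mul, Pi.mul_apply, sq]

def D0 (q : ℂ) : ℂ := ∏' n : ℕ, (1 - q ^ (n + 1)) ^ 24
def e4 : ℂ → ℂ := cuspFunction 1 E₄
def e6 : ℂ → ℂ := cuspFunction 1 E₆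
def Jf (q : ℂ) : ℂ := e4 q ^ 3 / D0 q

lemma Disc_eq (z : ℂ) : Disc z = qexp z * D0 (qexp z) := rfl

lemma e4_qexp (z : ℍ) : e4 (qexp z) = E₄ z := by
  rw [qexp_eq]
  exact SlashInvariantFormClass.eq_cuspFunction E₄ z one_mem_strictPeriods_SL one_ne_zero

lemma e6_qexp (z : ℍ) : e6 (qexp z) = E₆ z := by
  rw [qexp_eq]
  exact SlashInvariantFormClass.eq_cuspFunction E₆ z one_mem_strictPeriods_SL one_ne_zero

lemma Eis4_eq {z : ℂ} (hz : 0 < z.im) : Eis 4 z = e4 (qexp z) := by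
  rw [show z = ((⟨z, hz⟩ : ℍ) : ℂ) from rfl, e4_qexp, Eis_eq_E (by norm_num)]

lemma Eis6_eq {z : ℂ} (hz : 0 < z.im) : Eis 6 z = e6 (qexp z) := by
  rw [show z = ((⟨z, hz⟩ : ℍ) : ℂ) from rfl, e6_qexp, Eis_eq_E (by norm_num)]

lemma Eis8_eq {z : ℂ} (hz : 0 < z.im) : Eis 8 z = e4 (qexp z) ^ 2 := by
  rw [show z = ((⟨z, hz⟩ : ℍ) : ℂ) from rfl, e4_qexp, Eis_eq_E (by norm_num), ← E8_eq]

lemma Eis10_eq {z : ℂ} (hz : 0 < z.im) : Eis 10 z = e4 (qexp z) * e6 (qexp z) := by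
  rw [show z = ((⟨z, hz⟩ : ℍ) : ℂ) from rfl, e4_qexp, e6_qexp, Eis_eq_E (by norm_num), ← E10_eq]

lemma Eis14_eq {z : ℂ} (hz : 0 < z.im) : Eis 14 z = e4 (qexp z) ^ 2 * e6 (qexp z) := by
  rw [show z = ((⟨z, hz⟩ : ℍ) : ℂ) from rfl, e4_qexp, e6_qexp, Eis_eq_E (by norm_num), ← E14_eq]

lemma Disc_eq_discriminant (z : ℍ) : Disc z = ModularForm.discriminant z := by
  rw [discriminant_eq_q_prod, Disc_eq, D0]
  simp [qexp_eq, eta_q]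

lemma D0_zero : D0 0 = 1 := by simp [D0]

lemma D0_ne_zero {q : ℂ} (hq : ‖q‖ < 1) : D0 q ≠ 0 := by
  rcases eq_or_ne q 0 with rfl | h0
  · simp [D0_zero]
  · obtain ⟨z, hz, rfl⟩ := exists_qexp hq h0
    have h1 := Disc_eq_discriminant ⟨z, hz⟩
    have h2 := discriminant_ne_zero (⟨z, hz⟩ : ℍ)
    rw [← h1, Disc_eq] at h2
    exact right_ne_zero_of_mul h2

lemma D0_diff : DifferentiableOn ℂ D0 (Metric.ball 0 1) := differentiableOn_tprod_one_sub_pow_pow 24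

lemma e4_diff : DifferentiableOn ℂ e4 (Metric.ball 0 1) := fun q hq =>
  (ModularFormClass.differentiableAt_cuspFunction E₄ one_pos one_mem_strictPeriods_SL
    (by simpa using hq)).differentiableWithinAt

lemma e6_diff : DifferentiableOn ℂ e6 (Metric.ball 0 1) := fun q hq =>
  (ModularFormClass.differentiableAt_cuspFunction E₆ one_pos one_mem_strictPeriods_SL
    (by simpa using hq)).differentiableWithinAt

lemma Jf_diff : DifferentiableOn ℂ Jf (Metric.ball 0 1) :=
  (e4_diff.pow 3).div D0_diff fun q hq => D0_ne_zero (by simpa using hq)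

lemma an0 {g : ℂ → ℂ} (hg : DifferentiableOn ℂ g (Metric.ball 0 1)) : AnalyticAt ℂ g 0 :=
  hg.analyticAt (Metric.ball_mem_nhds _ one_pos)

lemma TS_e4 : TS e4 = qExpansion 1 E₄ := rfl
lemma TS_e6 : TS e6 = qExpansion 1 E₆ := rfl

lemma e4_zero : e4 0 = 1 := by
  rw [← TS_const e4, TS_e4, ← PowerSeries.coeff_zero_eq_constantCoeff_apply,
    E_qExpansion_coeff_zero _ ⟨2, rfl⟩]

lemma e6_zero : e6 0 = 1 := by
  rw [← TS_const e6, TS_e6, ← PowerSeries.coeff_zero_eq_constantCoeff_apply,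
    E_qExpansion_coeff_zero _ ⟨3, rfl⟩]

lemma Jf_zero : Jf 0 = 1 := by simp [Jf, e4_zero, D0_zero]

lemma e4_cube {q : ℂ} (hq : ‖q‖ < 1) : e4 q ^ 3 = D0 q * Jf q := by
  rw [Jf, mul_div_cancel₀ _ (D0_ne_zero hq)]

lemma e6_sq {q : ℂ} (hq : ‖q‖ < 1) : e6 q ^ 2 = D0 q * (Jf q - 1728 * q) := by
  rcases eq_or_ne q 0 with rfl | h0
  · simp [e6_zero, D0_zero, Jf_zero]
  · rw [mul_sub, ← e4_cube hq]
    obtain ⟨z, hz, rfl⟩ := exists_qexp hq h0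
    have h1 := Disc_eq_discriminant ⟨z, hz⟩
    rw [discriminant_eq_E₄_cube_sub_E₆_sq, Disc_eq, ← e4_qexp, ← e6_qexp] at h1
    simp only at h1
    linear_combination 1728 * h1

lemma jinv_eq {z : ℂ} (hz : 0 < z.im) : jinv z = Jf (qexp z) / qexp z := by
  rw [jinv, Jf, Eis4_eq hz, Disc_eq, div_div, mul_comm (qexp z)]

end EisM
section Contour
open scoped MatrixGroups ModularForm

lemma neg_inv_im_pos {z : ℂ} (hz : 0 < z.im) : 0 < (-1 / z).im :=
  by
    have := UpperHalfPlane.im_inv_neg_coe_pos ⟨z, hz⟩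
    simpa [neg_div, inv_neg] using this

lemma Disc_S {z : ℂ} (hz : 0 < z.im) : Disc (-1 / z) = z ^ 12 * Disc z := by
  have h0 : z ≠ 0 := by rintro rfl; simp at hz
  have h := congrFun ModularForm.discriminant_S_invariant ⟨z, hz⟩
  rw [ModularForm.SL_slash_apply, UpperHalfPlane.modular_S_smul, ← Disc_eq_discriminant,
    ← Disc_eq_discriminant] at h
  rw [ModularGroup.denom_S] at h
  simp at h
  rw [show -1 / z = -z⁻¹ by field_simp, ← h]
  field_simp

lemma Eis4_S {z : ℂ} (hz : 0 < z.im) : Eis 4 (-1 / z) = z ^ 4 * Eis 4 z := by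
  have h0 : z ≠ 0 := by rintro rfl; simp at hz
  have h := congrFun (SlashInvariantForm.slash_action_eqn ModularForm.E₄
    (Matrix.SpecialLinearGroup.mapGL ℝ ModularGroup.S) ⟨_, rfl⟩) ⟨z, hz⟩
  have h' : (⇑ModularForm.E₄ ∣[(4:ℤ)] ModularGroup.S) ⟨z, hz⟩ = ModularForm.E₄ ⟨z, hz⟩ := h
  rw [ModularForm.SL_slash_apply, UpperHalfPlane.modular_S_smul, ← Eis_eq_E, ← Eis_eq_E] at h'
  rw [ModularGroup.denom_S] at h'
  simp at h'
  rw [show -1 / z = -z⁻¹ by field_simp, ← h']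
  field_simp

lemma Disc_ne {z : ℂ} (hz : 0 < z.im) : Disc z ≠ 0 :=
  mul_ne_zero (qexp_ne_zero z) (D0_ne_zero (norm_qexp_lt_one hz))

lemma jinv_S {z : ℂ} (hz : 0 < z.im) : jinv (-1 / z) = jinv z := by
  have h0 : z ≠ 0 := by rintro rfl; simp at hz
  have := Disc_ne hz
  rw [jinv, jinv, Disc_S hz, Eis4_S hz]
  field_simp

lemma qexp_add_one (z : ℂ) : qexp (z + 1) = qexp z := by
  simp only [qexp]
  rw [show 2 * (π:ℂ) * Complex.I * (z + 1) = 2 * π * Complex.I * z + 2 * π * Complex.I by ring,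
        Complex.exp_periodic]

lemma Disc_T (z : ℂ) : Disc (z + 1) = Disc z := by rw [Disc_eq, qexp_add_one, Disc_eq]

lemma jinv_T {z : ℂ} (hz : 0 < z.im) : jinv (z + 1) = jinv z := by
  rw [jinv_eq hz, jinv_eq (by simpa using hz), qexp_add_one]

lemma isOpen_H : IsOpen {z : ℂ | 0 < z.im} := isOpen_lt continuous_const Complex.continuous_im

lemma qexp_diff : Differentiable ℂ qexp := by unfold qexp; fun_prop

lemma comp_q_diff {g : ℂ → ℂ} (hg : DifferentiableOn ℂ g (Metric.ball 0 1)) :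
    DifferentiableOn ℂ (fun z => g (qexp z)) {z : ℂ | 0 < z.im} :=
  hg.comp (t := Metric.ball 0 1) qexp_diff.differentiableOn
    (fun z hz => by simpa using norm_qexp_lt_one hz)

lemma Disc_diff : DifferentiableOn ℂ Disc {z : ℂ | 0 < z.im} :=
  qexp_diff.differentiableOn.mul (comp_q_diff D0_diff)

lemma jinv_diff : DifferentiableOn ℂ jinv {z : ℂ | 0 < z.im} :=
  ((comp_q_diff Jf_diff).div qexp_diff.differentiableOn (fun z _ => qexp_ne_zero z)).congr
    (fun z hz => jinv_eq hz)

/-- the integrand -/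
def gg (n : ℕ) (z : ℂ) : ℂ := jinv z ^ n * (deriv Disc z / Disc z)

lemma gg_diff (n : ℕ) : DifferentiableOn ℂ (gg n) {z : ℂ | 0 < z.im} :=
  (jinv_diff.pow n).mul ((Disc_diff.deriv isOpen_H).div Disc_diff (fun _ hz => Disc_ne hz))

lemma gg_T (n : ℕ) {z : ℂ} (hz : 0 < z.im) : gg n (z + 1) = gg n z := by
  have : deriv Disc (z + 1) = deriv Disc z := by
    rw [← deriv_comp_add_const]
    simp only [Disc_T]
  rw [gg, gg, jinv_T hz, Disc_T, this]

lemma gg_S (n : ℕ) {z : ℂ} (hz : 0 < z.im) :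
    gg n (-1 / z) / z ^ 2 = gg n z + 12 * jinv z ^ n / z := by
  have h0 : z ≠ 0 := by rintro rfl; simp at hz
  have hD := Disc_ne hz
  have d1 : HasDerivAt (fun z : ℂ => -1 / z) (1 / z ^ 2) z := by
    have := (hasDerivAt_inv h0).neg
    refine (this.congr_deriv (by simp)).congr_of_eventuallyEq ?_
    exact Filter.Eventually.of_forall fun w => by simp [neg_div]
  have d2 : HasDerivAt Disc (deriv Disc (-1/z)) (-1 / z) :=
    (Disc_diff.differentiableAt (isOpen_H.mem_nhds (neg_inv_im_pos hz))).hasDerivAt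
  have d3 : HasDerivAt Disc (deriv Disc z) z :=
    (Disc_diff.differentiableAt (isOpen_H.mem_nhds hz)).hasDerivAt
  have d4 := d2.comp z d1
  have d5 := ((hasDerivAt_pow 12 z).mul d3)
  have hev : (Disc ∘ fun z : ℂ => -1 / z) =ᶠ[𝓝 z] ((fun x => x ^ 12) * Disc) := by
    filter_upwards [isOpen_H.mem_nhds hz] with w hw
    exact Disc_S hw
  have := (d4.congr_of_eventuallyEq hev.symm).unique d5
  rw [gg, gg, jinv_S hz, Disc_S hz]
  have h2 : deriv Disc (-1 / z) = z ^ 2 * (12 * z ^ 11 * Disc z + z ^ 12 * deriv Disc z) := by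
    have e : deriv Disc (-1 / z) = z ^ 2 * (deriv Disc (-1 / z) * (1 / z ^ 2)) := by field_simp
    rw [e, this]; norm_num
  rw [h2]
  field_simp
  ring

/-- the big ball -/
def BB : Set ℂ := Metric.ball (2 * Complex.I) 2

lemma mem_BB (z : ℂ) : z ∈ BB ↔ z.re ^ 2 + z.im ^ 2 < 4 * z.im := by
  rw [BB, Metric.mem_ball, Complex.dist_eq, ← sq_lt_sq₀ (norm_nonneg _) (by norm_num),
    Complex.sq_norm, Complex.normSq_apply]
  simp
  constructor <;> intro h <;> nlinarith

lemma BB_sub : BB ⊆ {z : ℂ | 0 < z.im} := by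
  intro z hz
  rw [mem_BB] at hz
  show 0 < z.im
  nlinarith [sq_nonneg z.re, sq_nonneg z.im]

lemma arc_im {θ : ℝ} (h1 : π / 3 ≤ θ) (h2 : θ ≤ 2 * π / 3) :
    1 / 2 < (Complex.exp (θ * Complex.I)).im := by
  rw [Complex.exp_ofReal_mul_I_im]
  have hpi := Real.pi_pos
  have : Real.sin (π / 6) < Real.sin θ := by
    by_cases h : θ ≤ π / 2
    · exact Real.sin_lt_sin_of_lt_of_le_pi_div_two (by linarith) h (by linarith)
    · rw [← Real.sin_pi_sub θ]
      exact Real.sin_lt_sin_of_lt_of_le_pi_div_two (by linarith) (by linarith) (by linarith)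
  rwa [Real.sin_pi_div_six] at this

lemma arc_mem {θ : ℝ} (h1 : π / 3 ≤ θ) (h2 : θ ≤ 2 * π / 3) :
    Complex.exp (θ * Complex.I) ∈ BB := by
  rw [mem_BB]
  have := arc_im h1 h2
  rw [Complex.exp_ofReal_mul_I_im] at *
  rw [Complex.exp_ofReal_mul_I_re]
  nlinarith [Real.sin_sq_add_cos_sq θ]

lemma contour (n : ℕ) : ∫ x in (0:ℝ)..1, gg n (x + Complex.I) =
    12 * Complex.I * ∫ θ in (π / 2)..(2 * π / 3), jinv (Complex.exp (θ * Complex.I)) ^ n := by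
  have hpi := Real.pi_pos
  obtain ⟨G, hG⟩ := ((gg_diff n).mono BB_sub).isExactOn_ball
  change ∀ z ∈ BB, _ at hG
  have hsegm : ∀ x : ℝ, x ∈ Set.uIcc (0:ℝ) 1 → (x + Complex.I : ℂ) ∈ BB := by
    intro x hx
    rw [Set.uIcc_of_le zero_le_one] at hx
    rw [mem_BB]; simp; nlinarith [hx.1, hx.2]
  -- horizontal segment
  have s1 : ∫ x in (0:ℝ)..1, gg n (x + Complex.I) = G (Complex.I + 1) - G Complex.I := by
    have := intervalIntegral.integral_eq_sub_of_hasDerivAt (a := (0:ℝ)) (b := 1)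
      (f := fun x : ℝ => G (x + Complex.I)) (f' := fun x : ℝ => gg n (x + Complex.I)) ?_ ?_
    · rw [this]; simp [add_comm]
    · intro x hx
      have h1 := hG _ (hsegm x hx)
      have h2 : HasDerivAt (fun x : ℝ => (x + Complex.I : ℂ)) 1 x := by
        simpa using (Complex.ofRealCLM.hasDerivAt (x := x)).add_const Complex.I
      exact (h1.comp x h2).congr_deriv (by simp)
    · apply ContinuousOn.intervalIntegrable
      refine ((gg_diff n).continuousOn.comp (t := {z : ℂ | 0 < z.im}) (by fun_prop) ?_)
      intro x hx
      exact BB_sub (hsegm x hx)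
  -- translation
  have hconv : Convex ℝ (BB ∩ (fun z => z + 1) ⁻¹' BB) :=
    (convex_ball _ _).inter ((convex_ball _ _).translate_preimage_left 1)
  have hopen : IsOpen (BB ∩ (fun z => z + 1) ⁻¹' BB) :=
    Metric.isOpen_ball.inter (Metric.isOpen_ball.preimage (by fun_prop))
  have hder : ∀ z ∈ (BB ∩ (fun z => z + 1) ⁻¹' BB), HasDerivAt (fun z => G (z + 1) - G z) 0 z := by
    intro z hz
    have h1 := (hG _ hz.2).comp_add_const z 1
    have h2 := h1.sub (hG _ hz.1)
    rw [gg_T n (BB_sub hz.1), sub_self] at h2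
    exact h2
  have hrho : (2 * π / 3 : ℝ) = π - π / 3 := by ring
  have hr1 : Complex.exp ((π / 3 : ℝ) * Complex.I) =
      Complex.exp ((2 * π / 3 : ℝ) * Complex.I) + 1 := by
    apply Complex.ext
    · rw [Complex.add_re, Complex.exp_ofReal_mul_I_re, Complex.exp_ofReal_mul_I_re, hrho,
        Real.cos_pi_sub, Real.cos_pi_div_three]; norm_num
    · rw [Complex.add_im, Complex.exp_ofReal_mul_I_im, Complex.exp_ofReal_mul_I_im, hrho,
        Real.sin_pi_sub]; simp
  have s2 : G (Complex.I + 1) - G Complex.I =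
      G (Complex.exp ((π / 3 : ℝ) * Complex.I)) - G (Complex.exp ((2 * π / 3 : ℝ) * Complex.I)) := by
    rw [hr1]
    refine hopen.is_const_of_deriv_eq_zero (f := fun z => G (z + 1) - G z) hconv.isPreconnected
      (fun z hz => (hder z hz).differentiableAt.differentiableWithinAt)
      (fun z hz => (hder z hz).deriv) ⟨?_, ?_⟩ ⟨?_, ?_⟩
    · rw [mem_BB]; norm_num
    · rw [Set.mem_preimage, mem_BB]; norm_num
    · exact arc_mem (by linarith) le_rfl
    · rw [Set.mem_preimage, ← hr1]
      exact arc_mem le_rfl (by linarith)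
  -- arc
  have s3 : ∫ θ in (π / 2)..(2 * π / 3), -12 * Complex.I * jinv (Complex.exp (θ * Complex.I)) ^ n
      = G (Complex.exp ((2 * π / 3 : ℝ) * Complex.I)) - G (Complex.exp ((π / 3 : ℝ) * Complex.I)) := by
    have := intervalIntegral.integral_eq_sub_of_hasDerivAt (a := π / 2) (b := 2 * π / 3)
      (f := fun θ : ℝ => G (Complex.exp (θ * Complex.I)) - G (Complex.exp ((π - θ : ℝ) * Complex.I)))
      (f' := fun θ : ℝ => -12 * Complex.I * jinv (Complex.exp (θ * Complex.I)) ^ n) ?_ ?_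
    · rw [this]
      have e1 : π - 2 * π / 3 = π / 3 := by ring
      have e2 : π - π / 2 = π / 2 := by ring
      simp only [e1, e2, sub_self, sub_zero]
    · intro θ hθ
      rw [Set.uIcc_of_le (by linarith)] at hθ
      have m1 := arc_mem (θ := θ) (by linarith [hθ.1]) hθ.2
      have m2 := arc_mem (θ := π - θ) (by linarith [hθ.2]) (by linarith [hθ.1])
      have c1 : HasDerivAt (fun θ : ℝ => Complex.exp (θ * Complex.I))
          (Complex.exp (θ * Complex.I) * Complex.I) θ := by
        have : HasDerivAt (fun θ : ℝ => (θ * Complex.I : ℂ)) Complex.I θ := by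
          simpa using (Complex.ofRealCLM.hasDerivAt (x := θ)).mul_const Complex.I
        exact this.cexp
      have c2 : HasDerivAt (fun θ : ℝ => Complex.exp ((π - θ : ℝ) * Complex.I))
          (Complex.exp ((π - θ : ℝ) * Complex.I) * (-Complex.I)) θ := by
        have : HasDerivAt (fun θ : ℝ => ((π - θ : ℝ) * Complex.I : ℂ)) (-Complex.I) θ := by
          have := ((Complex.ofRealCLM.hasDerivAt (x := θ)).const_sub (π : ℂ)).mul_const Complex.I
          simpa using this
        exact this.cexp
      have d1 := (hG _ m1).comp θ c1
      have d2 := (hG _ m2).comp θ c2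
      have d := d1.sub d2
      refine d.congr_deriv ?_
      have hz := BB_sub m1
      have hw : Complex.exp ((π - θ : ℝ) * Complex.I) = -1 / Complex.exp (θ * Complex.I) := by
        push_cast
        rw [sub_mul, Complex.exp_sub, Complex.exp_pi_mul_I]
      rw [hw]
      have h0 := Complex.exp_ne_zero (θ * Complex.I)
      have hS := gg_S n hz
      set z := Complex.exp (θ * Complex.I)
      have hS' : gg n (-1 / z) = z ^ 2 * (gg n z + 12 * jinv z ^ n / z) := by
        rw [← hS]; field_simp
      rw [hS']
      field_simp
      ring
    · apply ContinuousOn.intervalIntegrable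
      refine continuousOn_const.mul (ContinuousOn.pow
        (jinv_diff.continuousOn.comp (t := {z : ℂ | 0 < z.im}) (by fun_prop) ?_) n)
      intro θ hθ
      rw [Set.uIcc_of_le (by linarith)] at hθ
      exact BB_sub (arc_mem (by linarith [hθ.1]) hθ.2)
  rw [intervalIntegral.integral_const_mul] at s3
  rw [s1, s2]
  linear_combination s3

end Contour
section Key

/-- logarithmic derivative of `D0`. -/
def LD (q : ℂ) : ℂ := q * deriv D0 q / D0 q

lemma dD0_diff : DifferentiableOn ℂ (deriv D0) (Metric.ball 0 1) := D0_diff.deriv Metric.isOpen_ball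

lemma LD_diff : DifferentiableOn ℂ LD (Metric.ball 0 1) :=
  (differentiableOn_id.mul dD0_diff).div D0_diff fun q hq => D0_ne_zero (by simpa using hq)

lemma ball_ev {P : ℂ → Prop} (h : ∀ q : ℂ, ‖q‖ < 1 → P q) : ∀ᶠ q in 𝓝 (0:ℂ), P q := by
  filter_upwards [Metric.ball_mem_nhds (0:ℂ) one_pos] with q hq
  exact h q (by simpa using hq)

lemma TS_id : TS (fun q => q) = PowerSeries.X := by
  have h := TS_unique (g := fun q => q) analyticAt_id (fun n => if n = 1 then 1 else 0) (by
    intro z hz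
    have := hasSum_single (f := fun n : ℕ => (if n = 1 then (1:ℂ) else 0) * qexp z ^ n) 1
      (fun n hn => by simp [hn])
    simpa using this)
  rw [h]
  ext n
  simp [PowerSeries.coeff_X]

lemma TS_cst (c : ℂ) : TS (fun _ => c) = PowerSeries.C c := by
  ext n
  rw [TS, PowerSeries.coeff_mk, PowerSeries.coeff_C, iteratedDeriv_const]
  split_ifs with h <;> simp [h]

lemma TS_D0_const : PowerSeries.constantCoeff (TS D0) = 1 := by rw [TS_const, D0_zero]
lemma TS_e4_const : PowerSeries.constantCoeff (TS e4) = 1 := by rw [TS_const, e4_zero]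
lemma TS_e6_const : PowerSeries.constantCoeff (TS e6) = 1 := by rw [TS_const, e6_zero]
lemma TS_Jf_const : PowerSeries.constantCoeff (TS Jf) = 1 := by rw [TS_const, Jf_zero]

lemma fL_D0 : fL (TS D0) = TS LD := by
  have h1 : TS (LD * D0) = TS ((fun q => q) * deriv D0) := TS_congr (ball_ev fun q hq => by
    have := D0_ne_zero hq
    simp only [Pi.mul_apply, LD]
    field_simp)
  rw [TS_mul (an0 LD_diff) (an0 D0_diff), TS_mul (f := fun q => q) analyticAt_id (an0 dD0_diff), TS_id,
    TS_deriv] at h1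
  rw [fL, ← h1, mul_assoc, PowerSeries.mul_inv_cancel _ (by rw [TS_D0_const]; exact one_ne_zero),
    mul_one]

lemma TS_cube : TS e4 ^ 3 = TS D0 * TS Jf := by
  rw [← TS_pow (an0 e4_diff), ← TS_mul (an0 D0_diff) (an0 Jf_diff)]
  exact TS_congr (ball_ev fun q hq => e4_cube hq)

lemma lin_diff (x : ℂ) : DifferentiableOn ℂ (Jf - fun q => x * q) (Metric.ball 0 1) :=
  Jf_diff.sub (by fun_prop)

lemma TS_lin (x : ℂ) : TS (Jf - fun q => x * q) = TS Jf - PowerSeries.C x * PowerSeries.X := by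
  rw [TS_sub (an0 Jf_diff) (by fun_prop), ← TS_id, ← TS_cst x,
    ← TS_mul (g := fun q => q) analyticAt_const analyticAt_id]
  rfl

lemma TS_sq : TS e6 ^ 2 = TS D0 * (TS Jf - PowerSeries.C 1728 * PowerSeries.X) := by
  rw [← TS_pow (an0 e6_diff), ← TS_lin, ← TS_mul (an0 D0_diff) (an0 (lin_diff _))]
  exact TS_congr (ball_ev fun q hq => e6_sq hq)

lemma cj_eq (n : ℕ) : cj n 0 = PowerSeries.coeff n (TS Jf ^ n) := by
  rw [← TS_pow (an0 Jf_diff), TS_coeff_integral (Jf_diff.pow n), cj, qCoeff]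
  congr 1
  ext u
  have hz : 0 < ((u:ℂ) + Complex.I).im := by simp
  simp [jinv_eq hz, div_pow]

lemma qexp_deriv (z : ℂ) : HasDerivAt qexp (2 * π * Complex.I * qexp z) z := by
  have h := ((hasDerivAt_id z).const_mul (2 * (π:ℂ) * Complex.I)).cexp
  refine h.congr_deriv ?_
  simp [qexp, mul_comm]

lemma Disc_logDeriv {z : ℂ} (hz : 0 < z.im) :
    deriv Disc z / Disc z = 2 * π * Complex.I * (1 + LD (qexp z)) := by
  have hq := norm_qexp_lt_one hz
  have h0 := D0_ne_zero hq
  have h1 := qexp_ne_zero z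
  have hd : HasDerivAt D0 (deriv D0 (qexp z)) (qexp z) :=
    (D0_diff.differentiableAt (Metric.isOpen_ball.mem_nhds (by simpa using hq))).hasDerivAt
  have h2 := (qexp_deriv z).mul (hd.comp z (qexp_deriv z))
  have h3 : HasDerivAt Disc _ z := h2
  rw [h3.deriv, Disc_eq, LD]
  simp only [Function.comp]
  field_simp

lemma key_id (n : ℕ) :
    lam (TS Jf) n (TS D0) + PowerSeries.coeff n (TS Jf ^ n) = 12 * Acoef n := by
  have h1 : TS (Jf ^ n * LD + Jf ^ n) = TS Jf ^ n * fL (TS D0) + TS Jf ^ n := by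
    have : TS (Jf ^ n * LD + Jf ^ n) = TS (Jf ^ n * LD - (fun _ => (-1:ℂ)) * Jf ^ n) := by
      congr 1; ext q; simp
    rw [this, TS_sub ((an0 (Jf_diff.pow n)).mul (an0 LD_diff))
      (analyticAt_const.mul (an0 (Jf_diff.pow n))), TS_mul (an0 (Jf_diff.pow n)) (an0 LD_diff),
      TS_mul analyticAt_const (an0 (Jf_diff.pow n)), TS_pow (an0 Jf_diff), TS_cst, fL_D0]
    simp
  rw [lam, ← map_add, ← h1, TS_coeff_integral (((Jf_diff.pow n).mul LD_diff).add (Jf_diff.pow n))]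
  have h2 : ∀ u : ℝ, (Jf ^ n * LD + Jf ^ n) (qexp (u + Complex.I)) / qexp (u + Complex.I) ^ n
      = (1 / (2 * π * Complex.I)) * gg n (u + Complex.I) := by
    intro u
    have hz : 0 < ((u:ℂ) + Complex.I).im := by simp
    have hpi : (π:ℂ) ≠ 0 := by exact_mod_cast Real.pi_ne_zero
    rw [gg, Disc_logDeriv hz, jinv_eq hz, div_pow]
    have h1 := qexp_ne_zero (u + Complex.I)
    simp only [Pi.add_apply, Pi.mul_apply, Pi.pow_apply]
    field_simp
    ring
  simp_rw [h2]
  rw [intervalIntegral.integral_const_mul, contour, Acoef]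
  have hpi : (π:ℂ) ≠ 0 := by exact_mod_cast Real.pi_ne_zero
  field_simp

lemma Acoef_re (n : ℕ) : (Acoef n).re = AcoefR n := by
  have hpi := Real.pi_pos
  have hintg : IntervalIntegrable (fun θ : ℝ => jinv (Complex.exp (θ * Complex.I)) ^ n) volume
      (Real.pi / 2) (2 * Real.pi / 3) := by
    apply ContinuousOn.intervalIntegrable
    refine (ContinuousOn.pow
      (jinv_diff.continuousOn.comp (t := {z : ℂ | 0 < z.im}) (by fun_prop) ?_) n)
    intro θ hθ
    rw [Set.uIcc_of_le (by linarith)] at hθ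
    exact BB_sub (arc_mem (by linarith [hθ.1]) hθ.2)
  rw [Acoef, AcoefR]
  have : (1 / (2 * (π:ℂ))) = ((1 / (2 * π) : ℝ) : ℂ) := by push_cast; rfl
  rw [this, Complex.re_ofReal_mul]
  congr 1
  have := Complex.reCLM.intervalIntegral_comp_comm hintg
  simpa using this.symm

end Key
section Pos
open scoped ComplexOrder ArithmeticFunction.sigma

/-- all coefficients positive -/
def PP (U : PowerSeries ℂ) : Prop := ∀ n, 0 < PowerSeries.coeff n U

lemma PP.mul {U V : PowerSeries ℂ} (hU : PP U) (hV : PP V) : PP (U * V) := by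
  intro n
  rw [PowerSeries.coeff_mul]
  exact Finset.sum_pos (fun p _ => mul_pos (hU _) (hV _)) ⟨(0, n), by simp⟩

lemma PP.pow {U : PowerSeries ℂ} (hU : PP U) {r : ℕ} (hr : 1 ≤ r) : PP (U ^ r) := by
  induction r, hr using Nat.le_induction with
  | base => simpa using hU
  | succ r _ ih => rw [pow_succ]; exact ih.mul hU

lemma sigma_posC (k n : ℕ) (hn : n ≠ 0) : 0 < ((σ k n : ℕ) : ℂ) := by
  have : 0 < σ k n := ArithmeticFunction.sigma_pos k n hn
  exact_mod_cast this

lemma PP_e4 : PP (TS e4) := by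
  intro n
  rw [TS_e4, EisensteinSeries.E_qExpansion_coeff _ ⟨2, rfl⟩]
  split_ifs with h
  · exact one_pos
  · refine mul_pos ?_ (sigma_posC _ _ h)
    rw [show _root_.bernoulli 4 = -1 / 30 by decide +kernel]
    norm_num

lemma LD_eq {z : ℂ} (hz : 0 < z.im) : 1 + LD (qexp z) = EisensteinSeries.E2 ⟨z, hz⟩ := by
  have h1 := Disc_logDeriv hz
  have h2 := ModularForm.logDeriv_eta_eq_E2 ⟨z, hz⟩
  have h3 : Disc =ᶠ[𝓝 z] fun w => ModularForm.eta w ^ 24 := by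
    filter_upwards [isOpen_H.mem_nhds hz] with w hw
    exact Disc_eq_discriminant ⟨w, hw⟩
  have hd : DifferentiableAt ℂ ModularForm.eta z :=
    ModularForm.differentiableAt_eta_of_mem_upperHalfPlaneSet hz
  have h4 : deriv Disc z / Disc z = 24 * logDeriv ModularForm.eta z := by
    rw [h3.deriv_eq, h3.eq_of_nhds, ← logDeriv_apply]
    rw [logDeriv_fun_pow hd]
    norm_num
  rw [h1] at h4
  have h2' : logDeriv ModularForm.eta z = π * Complex.I / 12 * EisensteinSeries.E2 ⟨z, hz⟩ := h2
  rw [h2'] at h4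
  have hpi : (π:ℂ) ≠ 0 := by exact_mod_cast Real.pi_ne_zero
  have hI := Complex.I_ne_zero
  field_simp at h4
  linear_combination h4 / 24

lemma TS_LD : TS LD = PowerSeries.mk fun n => if n = 0 then 0 else -24 * (σ 1 n : ℂ) := by
  refine TS_unique (an0 LD_diff) _ ?_
  intro z hz
  have h := EisensteinSeries.hasSum_qExpansion_E2 ⟨z, hz⟩
  rw [← LD_eq hz] at h
  have h1 := hasSum_single (f := fun n : ℕ => (if n = 0 then (1:ℂ) else 0)) 0
      (fun n hn => by simp [hn])
  have h2 := h.sub h1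
  rw [if_pos rfl, add_sub_cancel_left] at h2
  refine h2.congr_fun ?_
  intro n
  rcases eq_or_ne n 0 with rfl | hn
  · simp
  · simp [hn, qexp]

lemma PP_inv : PP (TS D0)⁻¹ := by
  have hD : PowerSeries.constantCoeff (TS D0) ≠ 0 := by rw [TS_D0_const]; exact one_ne_zero
  set P := (TS D0)⁻¹ with hP
  have h1 : TS D0 * P = 1 := PowerSeries.mul_inv_cancel _ hD
  have h0 : PowerSeries.constantCoeff P = 1 := by
    have := congrArg PowerSeries.constantCoeff h1
    simpa [TS_D0_const] using this
  have h2 : PowerSeries.X * PowerSeries.derivative ℂ P = - (P * fL (TS D0)) := by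
    have := congrArg (PowerSeries.derivative ℂ) h1
    rw [Derivation.leibniz, smul_eq_mul, smul_eq_mul, Derivation.map_one_eq_zero] at this
    rw [fL, ← hP]
    linear_combination PowerSeries.X * P * this -
      PowerSeries.X * PowerSeries.derivative ℂ P * h1
  intro n
  induction n using Nat.strong_induction_on with
  | _ n ih =>
    rcases n with _ | n
    · rw [PowerSeries.coeff_zero_eq_constantCoeff_apply, h0]; exact one_pos
    · have h3 := congrArg (PowerSeries.coeff (n+1)) h2
      rw [PowerSeries.coeff_succ_X_mul, PowerSeries.coeff_derivative, map_neg,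
        PowerSeries.coeff_mul, fL_D0, TS_LD, Finset.Nat.sum_antidiagonal_succ',
        PowerSeries.coeff_mk, if_pos rfl, mul_zero, zero_add, ← Finset.sum_neg_distrib] at h3
      have h4 : 0 < PowerSeries.coeff (n + 1) P * ((n:ℂ) + 1) := by
        rw [h3]
        refine Finset.sum_pos (fun p hp => ?_) ⟨(0, n), by simp⟩
        rw [PowerSeries.coeff_mk, if_neg (by omega)]
        have hp' := Finset.HasAntidiagonal.mem_antidiagonal.1 hp
        have := mul_pos (ih p.1 (by omega)) (sigma_posC 1 (p.2+1) (by omega))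
        have h24 : (0:ℂ) < 24 := by norm_num
        have := mul_pos h24 this
        convert this using 1
        ring
      have h5 : (0:ℂ) < (n:ℂ) + 1 := by exact_mod_cast Nat.succ_pos n
      exact (mul_pos_iff_of_pos_right h5).1 h4

lemma PP_Jf : PP (TS Jf) := by
  have hD : PowerSeries.constantCoeff (TS D0) ≠ 0 := by rw [TS_D0_const]; exact one_ne_zero
  have : TS Jf = TS e4 ^ 3 * (TS D0)⁻¹ := by
    rw [TS_cube, mul_right_comm, PowerSeries.mul_inv_cancel _ hD, one_mul]
  rw [this]
  exact (PP_e4.pow (by norm_num)).mul PP_inv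

lemma cj_pos {n : ℕ} (hn : 1 ≤ n) : 0 < (cj n 0).re := by
  have := PP_Jf.pow hn n
  rw [← cj_eq] at this
  exact (Complex.lt_def.1 this).1

end Pos
section Fin

/-- `∏ (Jf - x q)` -/
def pr (s : Multiset ℂ) : ℂ → ℂ := (s.map (fun x => (Jf - fun q => x * q))).prod

lemma pr_cons (x : ℂ) (s : Multiset ℂ) : pr (x ::ₘ s) = (Jf - fun q => x * q) * pr s := by
  simp [pr]

lemma pr_diff (s : Multiset ℂ) : DifferentiableOn ℂ (pr s) (Metric.ball 0 1) := by
  induction s using Multiset.induction_on with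
  | empty => simp only [pr, Multiset.map_zero, Multiset.prod_zero]; exact differentiableOn_const 1
  | cons x s ih => rw [pr_cons]; exact (lin_diff x).mul ih

lemma TS_pr (s : Multiset ℂ) :
    TS (pr s) = (s.map (fun x => TS Jf - PowerSeries.C x * PowerSeries.X)).prod := by
  induction s using Multiset.induction_on with
  | empty => simp [pr, TS_one]
  | cons x s ih =>
    rw [pr_cons, TS_mul (an0 (lin_diff x)) (an0 (pr_diff s)), ih, TS_lin, Multiset.map_cons,
      Multiset.prod_cons]

lemma pr_qexp {z : ℂ} (hz : 0 < z.im) (s : Multiset ℂ) :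
    pr s (qexp z) = qexp z ^ s.card * (s.map (fun x => jinv z - x)).prod := by
  induction s using Multiset.induction_on with
  | empty => simp [pr]
  | cons x s ih =>
    have := qexp_ne_zero z
    rw [pr_cons, Pi.mul_apply, ih, Multiset.map_cons, Multiset.prod_cons, Multiset.card_cons,
      jinv_eq hz]
    simp only [Pi.sub_apply]
    field_simp
    ring

lemma Eis_ab {k' : ℕ} (hk' : k' = 0 ∨ k' = 4 ∨ k' = 6 ∨ k' = 8 ∨ k' = 10 ∨ k' = 14) (n : ℕ) :
    ∃ a b : ℕ, 4 * a + 6 * b = k' ∧ CcoefR n k' = - (b * (1728 ^ n / 2)) ∧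
      ∀ z : ℂ, 0 < z.im → Eis k' z = e4 (qexp z) ^ a * e6 (qexp z) ^ b := by
  rcases hk' with rfl | rfl | rfl | rfl | rfl | rfl
  · exact ⟨0, 0, rfl, by simp [CcoefR], fun z hz => by simp [Eis]⟩
  · exact ⟨1, 0, rfl, by simp [CcoefR], fun z hz => by simp [Eis4_eq hz]⟩
  · exact ⟨0, 1, rfl, by simp [CcoefR, neg_div], fun z hz => by simp [Eis6_eq hz]⟩
  · exact ⟨2, 0, rfl, by simp [CcoefR], fun z hz => by simp [Eis8_eq hz]⟩
  · exact ⟨1, 1, rfl, by simp [CcoefR, neg_div], fun z hz => by simp [Eis10_eq hz]⟩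
  · exact ⟨2, 1, rfl, by simp [CcoefR, neg_div], fun z hz => by simp [Eis14_eq hz]⟩

lemma power_sum (n ℓ k' m : ℕ) (hn : 1 ≤ n)
    (hk' : k' = 0 ∨ k' = 4 ∨ k' = 6 ∨ k' = 8 ∨ k' = 10 ∨ k' = 14)
    (hhigh : m + n ≤ ℓ) (f : ℂ → ℂ) (F : Polynomial ℂ)
    (hf : IsMillerForm ℓ k' m f) (hF : IsFaber ℓ k' m f F) :
    ((F.roots.map (fun x => x ^ n)).sum).re =
      ((12 * ℓ + k' : ℕ) : ℝ) * AcoefR n - m * (cj n 0).re + CcoefR n k' := by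
  obtain ⟨a, b, hab, hC, hE⟩ := Eis_ab hk' n
  obtain ⟨-, -, -, c, hc, hcd⟩ := hf
  obtain ⟨hmon, hdeg, hfF⟩ := hF
  have hsp : F.Splits := IsAlgClosed.splits F
  have hcard : F.roots.card = ℓ - m := by rw [← hsp.natDegree_eq_card_roots, hdeg]
  have hev : ∀ w, F.eval w = (F.roots.map (fun x => w - x)).prod := by
    intro w
    rw [hsp.eval_eq_prod_roots]
    simp [hmon.leadingCoeff]
  set g : ℂ → ℂ := D0 ^ ℓ * e4 ^ a * e6 ^ b * pr F.roots with hg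
  have hgd : DifferentiableOn ℂ g (Metric.ball 0 1) :=
    (((D0_diff.pow ℓ).mul (e4_diff.pow a)).mul (e6_diff.pow b)).mul (pr_diff _)
  have hTg : TS g = TS D0 ^ ℓ * TS e4 ^ a * TS e6 ^ b *
      (F.roots.map (fun x => TS Jf - PowerSeries.C x * PowerSeries.X)).prod := by
    have i1 := an0 (D0_diff.pow ℓ)
    have i2 := an0 (e4_diff.pow a)
    have i3 := an0 (e6_diff.pow b)
    rw [hg, TS_mul ((i1.mul i2).mul i3) (an0 (pr_diff _)), TS_mul (i1.mul i2) i3, TS_mul i1 i2,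
      TS_pow (an0 D0_diff), TS_pow (an0 e4_diff), TS_pow (an0 e6_diff), TS_pr]
  have hTh : PowerSeries.X ^ m * TS g = PowerSeries.mk c := by
    have iX : AnalyticAt ℂ (fun q : ℂ => q) 0 := analyticAt_id
    rw [← TS_id, ← TS_pow iX, ← TS_mul (iX.pow m) (an0 hgd)]
    refine TS_unique ((iX.pow m).mul (an0 hgd)) c ?_
    intro z hz
    obtain ⟨h1, h2⟩ := hc z hz
    have h3 : ((fun q : ℂ => q) ^ m * g) (qexp z) = f z := by
      rw [hfF z hz, hev, hE z hz, Disc_eq]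
      simp only [hg, Pi.mul_apply, Pi.pow_apply]
      rw [pr_qexp hz, hcard, mul_pow]
      have : qexp z ^ ℓ = qexp z ^ m * qexp z ^ (ℓ - m) := by
        rw [← pow_add]; congr 1; omega
      rw [this]; ring
    rw [h3, h2]
    exact h1.hasSum
  have hW : ∀ i, 1 ≤ i → i ≤ ℓ - m → PowerSeries.coeff i (TS D0 ^ ℓ * TS e4 ^ a * TS e6 ^ b *
      (F.roots.map (fun x => TS Jf - PowerSeries.C x * PowerSeries.X)).prod) = 0 := by
    intro i hi1 hi2
    rw [← hTg]
    have := congrArg (PowerSeries.coeff (i + m)) hTh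
    rw [PowerSeries.coeff_X_pow_mul, PowerSeries.coeff_mk, hcd _ (by omega),
      if_neg (by omega)] at this
    exact this
  have := formal_identity (TS D0) (TS e4) (TS e6) (TS Jf) TS_D0_const TS_e4_const TS_e6_const
    TS_Jf_const TS_cube TS_sq n hn ℓ a b m hhigh F.roots hcard hW (Acoef n) (key_id n)
  rw [this, ← cj_eq, hC, ← hab, ← Acoef_re]
  have e1 : (12 * (ℓ:ℂ) + 4 * a + 6 * b) = ((12 * ℓ + (4 * a + 6 * b) : ℕ) : ℝ) := by
    push_cast; ring
  have e2 : (b:ℂ) * (1728 ^ n / 2) = ((b * (1728 ^ n / 2) : ℝ) : ℂ) := by push_cast; rfl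
  have e3 : (m:ℂ) = ((m:ℝ):ℂ) := by push_cast; rfl
  rw [e1, e2, e3, Complex.sub_re, Complex.sub_re, Complex.re_ofReal_mul, Complex.re_ofReal_mul,
    Complex.ofReal_re]
  ring

end Fin

/-- Fix `n ≥ 1`, `k = 12ℓ + k'` with `k' ∈ {0,4,6,8,10,14}`.  If
`(A_n/(-B_n))·k + C_n(k')/(-B_n) < m ≤ ℓ - n`, then at least one zero of `f_{k,m}` is
not on the arc, i.e. at least one zero of `F_{k,m}` lies outside `[0,1728]`.
(Here `A_n`, `B_n = -c_n(0)` and `C_n(k')` are real numbers, expressed through the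
real-valued versions `AcoefR`, `BcoefR`, `CcoefR`.) -/
theorem zero_off_arc_of_moment_negative (n ℓ k' m : ℕ) (hn : 1 ≤ n)
    (hk' : k' = 0 ∨ k' = 4 ∨ k' = 6 ∨ k' = 8 ∨ k' = 10 ∨ k' = 14)
    (hlow : (AcoefR n / (- BcoefR n)) * ((12 * ℓ + k' : ℕ) : ℝ)
              + CcoefR n k' / (- BcoefR n) < (m : ℝ))
    (hhigh : m + n ≤ ℓ)
    (f : ℂ → ℂ) (F : Polynomial ℂ)
    (hf : IsMillerForm ℓ k' m f) (hF : IsFaber ℓ k' m f F) :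
    ∃ x ∈ F.roots, ¬ ∃ r : ℝ, r ∈ Set.Icc (0 : ℝ) 1728 ∧ x = (r : ℂ) := by
  by_contra hcon
  push Not at hcon
  have hps := power_sum n ℓ k' m hn hk' hhigh f F hf hF
  have hc := cj_pos hn
  have hB : - BcoefR n = (cj n 0).re := by simp [BcoefR]
  rw [hB, div_mul_eq_mul_div, ← add_div, div_lt_iff₀ hc] at hlow
  have hneg : ((F.roots.map (fun x => x ^ n)).sum).re < 0 := by rw [hps]; linarith
  have hnn : 0 ≤ ((F.roots.map (fun x => x ^ n)).sum).re := by
    have : ((F.roots.map (fun x => x ^ n)).sum).re =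
        (F.roots.map (fun x => (x ^ n).re)).sum := by
      have h := map_multiset_sum Complex.reAddGroupHom (F.roots.map (fun x => x ^ n))
      rw [Multiset.map_map] at h
      exact h
    rw [this]
    refine Multiset.sum_nonneg ?_
    intro y hy
    obtain ⟨x, hx, rfl⟩ := Multiset.mem_map.1 hy
    obtain ⟨r, hr, rfl⟩ := hcon x hx
    rw [← Complex.ofReal_pow, Complex.ofReal_re]
    exact pow_nonneg hr.1 n
  linarith
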